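/- arXiv:2405.10912 — 11 statements merged into one kernel-verified Lean document; each statement's English description precedes it below -/
import Mathlib

section
/- Let I = {a} be a one-element input type, let the actual input sequence πI be constantly {a} (πI n = {a} for all n), and let C = {ρ an input sequence | {n | a ∈ ρ n} is infinite}. Then there exists an infinite sequence ρ : ℕ → (input sequences) such that ρ i ∉ C for every i and ρ (i+1) <subset_π ρ i for every i. In particular, <subset_π restricted to the complement of C is not well-founded, i.e., the subset similarity relation does not satisfy the limit assumption. -/
/-- The changes between two input sequences: pairs `(a, n)` where the sequences disagree
on whether input `a` holds at position `n`. -/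
def changes {I : Type} (ρ ρ' : ℕ → Set I) : Set (I × ℕ) :=
  {p | ¬ (p.1 ∈ ρ p.2 ↔ p.1 ∈ ρ' p.2)}

/-- With a one-element input type `I = {a}`, the actual input sequence constantly `{a}`,
and the cause candidate `C` of sequences containing `a` infinitely often, there is an
infinite strictly `<subset_π`-descending chain outside `C`; hence the subset similarity
relation does not satisfy the limit assumption. -/
theorem subset_not_limit_assumption {I : Type} (a : I) (hI : ∀ b : I, b = a)
    (πI : ℕ → Set I) (hπ : ∀ n, πI n = {a})
    (C : Set (ℕ → Set I)) (hC : C = {ρ : ℕ → Set I | {n : ℕ | a ∈ ρ n}.Infinite}) :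
    ∃ ρ : ℕ → (ℕ → Set I),
      (∀ i, ρ i ∉ C) ∧ (∀ i, changes (ρ (i + 1)) πI ⊂ changes (ρ i) πI) := by
  have hchanges : ∀ i, changes (fun n => {_x : I | n < i}) πI = {p : I × ℕ | i ≤ p.2} := by
    intro i
    ext p
    simp [changes, hπ, hI p.1]
  refine ⟨fun i n => {_x | n < i}, fun i => ?_, fun i => ?_⟩
  · subst hC
    simpa using Set.finite_lt_nat i
  · rw [hchanges, hchanges]
    exact ⟨fun p hp => Nat.le_of_succ_le hp,
      fun h => Nat.not_succ_le_self i (h (show ((a, i) : I × ℕ) ∈ _ from le_refl i))⟩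
end

section
/- Let I = {a} be a one-element input type and let the actual input sequence πI be constantly {a} (πI n = {a} for all n). For every input sequence ρ such that {n | a ∈ ρ n} is finite, there exists an input sequence ρ' with {n | a ∈ ρ' n} finite and ρ' <subset_π ρ. Consequently, the set of input sequences containing a at only finitely many positions has no <subset_π-minimal element. -/
/-- Correcting a sequence at one position removes exactly the changes at that position. -/
theorem changes_update {I : Type} (ρ π : ℕ → Set I) (m : ℕ) :
    changes (Function.update ρ m (π m)) π = changes ρ π \ {p | p.2 = m} := by
  ext ⟨b, n⟩
  by_cases h : n = m
  · subst h
    simp [changes]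
  · simp [changes, h]

/-- Correcting a sequence at a position where it disagrees strictly shrinks the changes. -/
theorem changes_update_ssubset {I : Type} {ρ π : ℕ → Set I} {b : I} {m : ℕ}
    (h : (b, m) ∈ changes ρ π) :
    changes (Function.update ρ m (π m)) π ⊂ changes ρ π := by
  rw [changes_update]
  exact Set.sdiff_ssubset_left_iff.2 ⟨(b, m), h, rfl⟩

/-- With a one-element input type `I = {a}` and the actual input sequence constantly `{a}`,
every input sequence containing `a` at only finitely many positions has a strictly
`<subset_π`-closer such sequence; consequently, the set of such sequences has no
`<subset_π`-minimal element. -/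
theorem finitely_many_no_minimal {I : Type} (a : I) (hI : ∀ b : I, b = a)
    (πI : ℕ → Set I) (hπ : ∀ n, πI n = {a}) :
    (∀ ρ : ℕ → Set I, {n : ℕ | a ∈ ρ n}.Finite →
      ∃ ρ' : ℕ → Set I, {n : ℕ | a ∈ ρ' n}.Finite ∧ changes ρ' πI ⊂ changes ρ πI) ∧
    ¬ ∃ ρ : ℕ → Set I, {n : ℕ | a ∈ ρ n}.Finite ∧
        ∀ ρ' : ℕ → Set I, {n : ℕ | a ∈ ρ' n}.Finite → ¬ (changes ρ' πI ⊂ changes ρ πI) := by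
  have closer : ∀ ρ : ℕ → Set I, {n : ℕ | a ∈ ρ n}.Finite →
      ∃ ρ' : ℕ → Set I, {n : ℕ | a ∈ ρ' n}.Finite ∧ changes ρ' πI ⊂ changes ρ πI := by
    intro ρ hρ
    obtain ⟨m, hm⟩ := hρ.exists_notMem
    have hm' : a ∉ ρ m := hm
    refine ⟨Function.update ρ m (πI m), (hρ.insert m).subset fun n hn => ?_,
      changes_update_ssubset (b := a) (by simp [changes, hπ, hm'])⟩
    by_cases h : n = m
    · exact Or.inl h
    · exact Or.inr (by simpa [h] using hn)
  refine ⟨closer, ?_⟩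
  rintro ⟨ρ, hρ, hmin⟩
  obtain ⟨ρ', hρ', hlt⟩ := closer ρ hρ
  exact hmin ρ' hρ' hlt
end

section
/- Assume the input type I is finite. For every actual input sequence πI, the strict relation <full_π on input sequences is well-founded: there is no infinite sequence ρ : ℕ → (input sequences) with ρ (i+1) <full_π ρ i for all i. Hence the full similarity relation satisfies the limit assumption. -/
/-- The full similarity relation of an actual input sequence `πI`:
`σ ≤full_π τ` iff the changes of `σ` w.r.t. `πI` are contained in those of `τ`, and
for every input `a` on which `σ` differs from `πI` infinitely often, `σ` and `τ` agree
on `a` everywhere. -/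
def leFull {I : Type} (πI σ τ : ℕ → Set I) : Prop :=
  changes σ πI ⊆ changes τ πI ∧
    ∀ a : I, {n : ℕ | ¬ (a ∈ σ n ↔ a ∈ πI n)}.Infinite → ∀ n, (a ∈ σ n ↔ a ∈ τ n)

/-- An antitone sequence of sets with a finite member is eventually constant. -/
theorem Antitone.eventually_succ_eq_of_finite {α : Type*} {D : ℕ → Set α} (hD : Antitone D)
    {k : ℕ} (hk : (D k).Finite) : ∀ᶠ i in Filter.atTop, D (i + 1) = D i := by
  obtain ⟨m, hm⟩ := exists_minimal_of_wellFoundedLT (fun n : ℕ => ∃ i, k ≤ i ∧ (D i).ncard = n)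
    ⟨_, k, le_rfl, rfl⟩
  obtain ⟨⟨j, hkj, rfl⟩, hmin⟩ := hm
  have hj : ∀ i, j ≤ i → D i = D j := fun i hi =>
    Set.eq_of_subset_of_ncard_le (hD hi)
      ((le_total _ _).elim id fun h => hmin ⟨i, hkj.trans hi, rfl⟩ h) (hk.subset (hD hkj))
  filter_upwards [Filter.eventually_ge_atTop j] with i hi
  rw [hj i hi, hj (i + 1) (by omega)]

/-- Along a `leFull`-descending sequence, the values at each single input stabilize. -/
theorem eventually_agree_of_leFull {I : Type} {πI : ℕ → Set I} {ρ : ℕ → (ℕ → Set I)}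
    (hρ : ∀ i, leFull πI (ρ (i + 1)) (ρ i)) (a : I) :
    ∀ᶠ i in Filter.atTop, ∀ n, (a ∈ ρ (i + 1) n ↔ a ∈ ρ i n) := by
  by_cases h : ∃ k, {n : ℕ | ¬ (a ∈ ρ k n ↔ a ∈ πI n)}.Finite
  · obtain ⟨k, hk⟩ := h
    have hD : Antitone fun i => {n : ℕ | ¬ (a ∈ ρ i n ↔ a ∈ πI n)} :=
      antitone_nat_of_succ_le fun i n hn => (hρ i).1 (show (a, n) ∈ changes _ _ from hn)
    filter_upwards [hD.eventually_succ_eq_of_finite hk] with i hi n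
    have := Set.ext_iff.1 hi n
    simp only [Set.mem_ofPred_eq] at this
    tauto
  · exact Filter.Eventually.of_forall fun i => (hρ i).2 a (not_exists.1 h (i + 1))

/-- For a finite input type, the strict part of the full similarity relation is
well-founded: there is no infinite strictly descending chain. Hence the full
similarity relation satisfies the limit assumption. -/
theorem full_limit_assumption {I : Type} [Finite I] (πI : ℕ → Set I) :
    ¬ ∃ ρ : ℕ → (ℕ → Set I),
        ∀ i, leFull πI (ρ (i + 1)) (ρ i) ∧ ρ (i + 1) ≠ ρ i := by
  rintro ⟨ρ, hρ⟩
  obtain ⟨i, hi⟩ :=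
    (Filter.eventually_all.2 (eventually_agree_of_leFull fun i => (hρ i).1)).exists
  exact (hρ i).2 (funext fun n => Set.ext fun a => hi a n)
end

section
/- Let T be a set of traces, π ∈ T, ≤_π a comparative similarity relation whose strict part <_π is well-founded (the limit assumption), E a set of traces, and C a set of input sequences. Then PC2 holds iff CF holds: for every ≤_π-minimal input sequence π0 ∉ C there exists π2 ∈ T with π2|_I = π0 and π2 ∉ E, if and only if for every input sequence π0 ∉ C there exist an input sequence π1 ∉ C with π1 ≤_π π0 and a trace π2 ∈ T with π2|_I = π1 and π2 ∉ E. -/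
/-- The input projection of a trace. -/
def inputProj {I O : Type} (π : ℕ → Set (I ⊕ O)) : ℕ → Set I :=
  fun n => {i | Sum.inl i ∈ π n}

/-- SAT: every trace of the system that is input-equivalent to the actual trace `π`
has its input projection in `C` and satisfies the effect `E`. -/
def SAT {I O : Type} (T : Set (ℕ → Set (I ⊕ O))) (π : ℕ → Set (I ⊕ O))
    (E : Set (ℕ → Set (I ⊕ O))) (C : Set (ℕ → Set I)) : Prop :=
  ∀ π0 ∈ T, inputProj π0 = inputProj π → inputProj π0 ∈ C ∧ π0 ∈ E

/-- CF: for every input sequence outside `C` there is an at-least-as-close input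
sequence outside `C` realized by a system trace avoiding the effect. -/
def CF {I O : Type} (T : Set (ℕ → Set (I ⊕ O)))
    (le : (ℕ → Set I) → (ℕ → Set I) → Prop)
    (E : Set (ℕ → Set (I ⊕ O))) (C : Set (ℕ → Set I)) : Prop :=
  ∀ π0 : ℕ → Set I, π0 ∉ C →
    ∃ π1 : ℕ → Set I, π1 ∉ C ∧ le π1 π0 ∧
      ∃ π2 ∈ T, inputProj π2 = π1 ∧ π2 ∉ E

/-- MIN: no strict subset of `C` satisfies both SAT and CF. -/
def MIN {I O : Type} (T : Set (ℕ → Set (I ⊕ O))) (π : ℕ → Set (I ⊕ O))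
    (le : (ℕ → Set I) → (ℕ → Set I) → Prop)
    (E : Set (ℕ → Set (I ⊕ O))) (C : Set (ℕ → Set I)) : Prop :=
  ¬ ∃ C' : Set (ℕ → Set I), C' ⊂ C ∧ SAT T π E C' ∧ CF T le E C'

/-- `C` is a cause of `E` on `π` in `T`. -/
def IsCause {I O : Type} (T : Set (ℕ → Set (I ⊕ O))) (π : ℕ → Set (I ⊕ O))
    (le : (ℕ → Set I) → (ℕ → Set I) → Prop)
    (E : Set (ℕ → Set (I ⊕ O))) (C : Set (ℕ → Set I)) : Prop :=
  SAT T π E C ∧ CF T le E C ∧ MIN T π le E C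

/-- PC2: every ≤_π-minimal input sequence outside `C` is realized by a system trace
avoiding the effect. -/
def PC2 {I O : Type} (T : Set (ℕ → Set (I ⊕ O)))
    (le : (ℕ → Set I) → (ℕ → Set I) → Prop)
    (E : Set (ℕ → Set (I ⊕ O))) (C : Set (ℕ → Set I)) : Prop :=
  ∀ π0 : ℕ → Set I, π0 ∉ C →
    (∀ π1 : ℕ → Set I, π1 ∉ C → ¬ (le π1 π0 ∧ π1 ≠ π0)) →
    ∃ π2 ∈ T, inputProj π2 = π0 ∧ π2 ∉ E

/-- If the similarity relation satisfies the limit assumption (its strict part is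
well-founded), then PC2 holds iff CF holds. -/
theorem PC2_iff_CF {I O : Type} (T : Set (ℕ → Set (I ⊕ O)))
    (π : ℕ → Set (I ⊕ O)) (hπ : π ∈ T)
    (le : (ℕ → Set I) → (ℕ → Set I) → Prop)
    (hrefl : ∀ ρ, le ρ ρ)
    (htrans : ∀ ρ0 ρ1 ρ2, le ρ0 ρ1 → le ρ1 ρ2 → le ρ0 ρ2)
    (hantisymm : ∀ ρ0 ρ1, le ρ0 ρ1 → le ρ1 ρ0 → ρ0 = ρ1)
    (hmin : ∀ ρ, le (inputProj π) ρ)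
    (hwf : WellFounded (fun σ τ : ℕ → Set I => le σ τ ∧ σ ≠ τ))
    (E : Set (ℕ → Set (I ⊕ O))) (C : Set (ℕ → Set I)) :
    PC2 T le E C ↔ CF T le E C := by
  constructor
  · intro hPC π0
    induction π0 using hwf.induction with
    | _ π0 ih =>
      intro h0
      by_cases hm : ∃ π1, π1 ∉ C ∧ le π1 π0 ∧ π1 ≠ π0
      · obtain ⟨π1, h1, hlt⟩ := hm
        obtain ⟨ρ, hρ, hle, hreal⟩ := ih π1 hlt h1
        exact ⟨ρ, hρ, htrans _ _ _ hle hlt.1, hreal⟩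
      · exact ⟨π0, h0, hrefl π0, hPC π0 h0 fun π1 h1 hlt => hm ⟨π1, h1, hlt⟩⟩
  · intro hCF π0 h0 hmin0
    obtain ⟨π1, h1, hle, hreal⟩ := hCF π0 h0
    obtain rfl : π1 = π0 := by_contra fun hne => hmin0 π1 h1 ⟨hle, hne⟩
    exact hreal
end

section
/- Let T be a set of traces, π ∈ T a trace that is deterministic in T (every π1 ∈ T with π1 =_I π equals π), ≤_π a comparative similarity relation whose strict part <_π is well-founded (the limit assumption), and E a set of traces. Then a set C of input sequences satisfies SAT, CF, and MIN (i.e., is a cause of E on π in T) if and only if C satisfies PC1, PC2, and PC3. -/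
/-- PC1: the actual trace satisfies the cause (on inputs) and the effect. -/
def PC1 {I O : Type} (π : ℕ → Set (I ⊕ O))
    (E : Set (ℕ → Set (I ⊕ O))) (C : Set (ℕ → Set I)) : Prop :=
  inputProj π ∈ C ∧ π ∈ E

/-- PC3: no strict subset of `C` satisfies both PC1 and PC2. -/
def PC3 {I O : Type} (T : Set (ℕ → Set (I ⊕ O))) (π : ℕ → Set (I ⊕ O))
    (le : (ℕ → Set I) → (ℕ → Set I) → Prop)
    (E : Set (ℕ → Set (I ⊕ O))) (C : Set (ℕ → Set I)) : Prop :=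
  ¬ ∃ C' : Set (ℕ → Set I), C' ⊂ C ∧ PC1 π E C' ∧ PC2 T le E C'

theorem SAT_iff_PC1 {I O : Type} {T : Set (ℕ → Set (I ⊕ O))} {π : ℕ → Set (I ⊕ O)}
    (hπ : π ∈ T) (hdet : ∀ π1 ∈ T, inputProj π1 = inputProj π → π1 = π)
    (E : Set (ℕ → Set (I ⊕ O))) (C : Set (ℕ → Set I)) :
    SAT T π E C ↔ PC1 π E C := by
  constructor
  · intro h
    exact h π hπ rfl
  · intro h π0 hπ0 heq
    obtain rfl := hdet π0 hπ0 heq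
    exact h

theorem CF_iff_PC2 {I O : Type} (T : Set (ℕ → Set (I ⊕ O)))
    {le : (ℕ → Set I) → (ℕ → Set I) → Prop}
    (hrefl : ∀ ρ, le ρ ρ)
    (htrans : ∀ ρ0 ρ1 ρ2, le ρ0 ρ1 → le ρ1 ρ2 → le ρ0 ρ2)
    (hwf : WellFounded (fun σ τ : ℕ → Set I => le σ τ ∧ σ ≠ τ))
    (E : Set (ℕ → Set (I ⊕ O))) (C : Set (ℕ → Set I)) :
    CF T le E C ↔ PC2 T le E C := by
  constructor
  · intro h π0 hπ0 hmin
    obtain ⟨π1, hπ1, hle, hreal⟩ := h π0 hπ0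
    obtain rfl : π1 = π0 := by_contra fun hne => hmin π1 hπ1 ⟨hle, hne⟩
    exact hreal
  · intro h π0 hπ0
    obtain ⟨σ, ⟨hσC, hσ⟩, hσmin⟩ :=
      hwf.has_min {σ | σ ∉ C ∧ le σ π0} ⟨π0, hπ0, hrefl π0⟩
    exact ⟨σ, hσC, hσ, h σ hσC fun τ hτC hτ =>
      hσmin τ ⟨hτC, htrans τ σ π0 hτ.1 hσ⟩ hτ⟩

/-- For a deterministic actual trace and a similarity relation satisfying the limit
assumption, our definition of temporal causality (SAT, CF, MIN) coincides with
Coenen et al.'s definition (PC1, PC2, PC3). -/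
theorem cause_iff_coenen {I O : Type} (T : Set (ℕ → Set (I ⊕ O)))
    (π : ℕ → Set (I ⊕ O)) (hπ : π ∈ T)
    (hdet : ∀ π1 ∈ T, inputProj π1 = inputProj π → π1 = π)
    (le : (ℕ → Set I) → (ℕ → Set I) → Prop)
    (hrefl : ∀ ρ, le ρ ρ)
    (htrans : ∀ ρ0 ρ1 ρ2, le ρ0 ρ1 → le ρ1 ρ2 → le ρ0 ρ2)
    (hantisymm : ∀ ρ0 ρ1, le ρ0 ρ1 → le ρ1 ρ0 → ρ0 = ρ1)
    (hmin : ∀ ρ, le (inputProj π) ρ)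
    (hwf : WellFounded (fun σ τ : ℕ → Set I => le σ τ ∧ σ ≠ τ))
    (E : Set (ℕ → Set (I ⊕ O))) (C : Set (ℕ → Set I)) :
    IsCause T π le E C ↔ (PC1 π E C ∧ PC2 T le E C ∧ PC3 T π le E C) := by
  simp only [IsCause, MIN, PC3, SAT_iff_PC1 hπ hdet, CF_iff_PC2 T hrefl htrans hwf]
end

section
/- Let T be a set of traces, π ∈ T, ≤_π a comparative similarity relation, and E a set of traces. If the set D = {ρ an input sequence | ∀ σ ∈ T, σ|_I ≤_π ρ → σ ∈ E} is nonempty, then D is a cause of E on π in T, i.e., D satisfies SAT, CF, and MIN. -/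
/-- If the set `D` of input sequences all of whose at-least-as-close system
realizations satisfy the effect is nonempty, then `D` is a cause of `E` on `π` in `T`. -/
theorem D_isCause {I O : Type} (T : Set (ℕ → Set (I ⊕ O)))
    (π : ℕ → Set (I ⊕ O)) (hπ : π ∈ T)
    (le : (ℕ → Set I) → (ℕ → Set I) → Prop)
    (hrefl : ∀ ρ, le ρ ρ)
    (htrans : ∀ ρ0 ρ1 ρ2, le ρ0 ρ1 → le ρ1 ρ2 → le ρ0 ρ2)
    (hantisymm : ∀ ρ0 ρ1, le ρ0 ρ1 → le ρ1 ρ0 → ρ0 = ρ1)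
    (hmin : ∀ ρ, le (inputProj π) ρ)
    (E : Set (ℕ → Set (I ⊕ O)))
    (D : Set (ℕ → Set I))
    (hD : D = {ρ : ℕ → Set I | ∀ σ ∈ T, le (inputProj σ) ρ → σ ∈ E})
    (hne : D.Nonempty) :
    IsCause T π le E D := by
  subst hD
  obtain ⟨ρ, hρ⟩ := hne
  refine ⟨?_, ?_, ?_⟩
  · intro π0 hπ0 heq
    refine ⟨fun σ hσ hle => ?_, hρ π0 hπ0 (heq ▸ hmin ρ)⟩
    have hσπ : inputProj σ = inputProj π := hantisymm _ _ (heq ▸ hle) (hmin _)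
    exact hρ σ hσ (hσπ ▸ hmin ρ)
  · intro π0 hπ0
    simp only [Set.mem_ofPred_eq, not_forall] at hπ0
    obtain ⟨σ, hσ, hle, hσE⟩ := hπ0
    exact ⟨inputProj σ, fun h => hσE (h σ hσ (hrefl _)), hle, σ, hσ, rfl, hσE⟩
  · rintro ⟨C', hC', -, hCF⟩
    obtain ⟨x, hx, hxC'⟩ := Set.exists_of_ssubset hC'
    obtain ⟨_, -, hle, σ, hσ, rfl, hσE⟩ := hCF x hxC'
    exact hσE (hx σ hσ hle)
end

section
/- Causes are unique: let T be a set of traces, π ∈ T, ≤_π a comparative similarity relation, and E a set of traces. If C and C' are both causes of E on π in T (each satisfies SAT, CF, and MIN), then C = C'. -/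
theorem SAT.inter {I O : Type} {T : Set (ℕ → Set (I ⊕ O))} {π : ℕ → Set (I ⊕ O)}
    {E : Set (ℕ → Set (I ⊕ O))} {C C' : Set (ℕ → Set I)}
    (h : SAT T π E C) (h' : SAT T π E C') : SAT T π E (C ∩ C') :=
  fun π0 h0 heq => ⟨⟨(h π0 h0 heq).1, (h' π0 h0 heq).1⟩, (h π0 h0 heq).2⟩

theorem CF.inter {I O : Type} {T : Set (ℕ → Set (I ⊕ O))}
    {le : (ℕ → Set I) → (ℕ → Set I) → Prop}
    {E : Set (ℕ → Set (I ⊕ O))} {C C' : Set (ℕ → Set I)}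
    (h : CF T le E C) (h' : CF T le E C') : CF T le E (C ∩ C') := by
  intro π0 h0
  by_cases hc : π0 ∈ C
  · obtain ⟨π1, h1, hr⟩ := h' π0 fun hc' => h0 ⟨hc, hc'⟩
    exact ⟨π1, fun hm => h1 hm.2, hr⟩
  · obtain ⟨π1, h1, hr⟩ := h π0 hc
    exact ⟨π1, fun hm => h1 hm.1, hr⟩

/-- A cause is contained in every set satisfying SAT and CF. -/
theorem IsCause.subset {I O : Type} {T : Set (ℕ → Set (I ⊕ O))} {π : ℕ → Set (I ⊕ O)}
    {le : (ℕ → Set I) → (ℕ → Set I) → Prop}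
    {E : Set (ℕ → Set (I ⊕ O))} {C C' : Set (ℕ → Set I)}
    (h : IsCause T π le E C) (hs : SAT T π E C') (hf : CF T le E C') : C ⊆ C' := by
  by_contra hn
  exact h.2.2 ⟨C ∩ C', ⟨Set.inter_subset_left, fun hsub => hn fun _ hx => (hsub hx).2⟩,
    h.1.inter hs, h.2.1.inter hf⟩

/-- Causes are unique: two causes of the same effect on the same trace coincide. -/
theorem cause_unique {I O : Type} (T : Set (ℕ → Set (I ⊕ O)))
    (π : ℕ → Set (I ⊕ O)) (hπ : π ∈ T)
    (le : (ℕ → Set I) → (ℕ → Set I) → Prop)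
    (hrefl : ∀ ρ, le ρ ρ)
    (htrans : ∀ ρ0 ρ1 ρ2, le ρ0 ρ1 → le ρ1 ρ2 → le ρ0 ρ2)
    (hantisymm : ∀ ρ0 ρ1, le ρ0 ρ1 → le ρ1 ρ0 → ρ0 = ρ1)
    (hmin : ∀ ρ, le (inputProj π) ρ)
    (E : Set (ℕ → Set (I ⊕ O)))
    (C C' : Set (ℕ → Set I))
    (hC : IsCause T π le E C) (hC' : IsCause T π le E C') :
    C = C' :=
  (hC.subset hC'.1 hC'.2.1).antisymm (hC'.subset hC.1 hC.2.1)
end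

section
/- Let T be a set of traces, π ∈ T, ≤_π a comparative similarity relation, and E a set of traces, and let D = {ρ an input sequence | ∀ σ ∈ T, σ|_I ≤_π ρ → σ ∈ E}. Then a set C of input sequences is a cause of E on π in T if and only if D is nonempty and C = D. In particular, a cause of E on π in T exists if and only if D ≠ ∅. -/
/-- The input sequences all of whose at-least-as-close system traces satisfy the effect. -/
def closeEffectSet {I O : Type} (T : Set (ℕ → Set (I ⊕ O)))
    (le : (ℕ → Set I) → (ℕ → Set I) → Prop) (E : Set (ℕ → Set (I ⊕ O))) :
    Set (ℕ → Set I) :=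
  {ρ | ∀ σ ∈ T, le (inputProj σ) ρ → σ ∈ E}

theorem CF.closeEffectSet_subset {I O : Type} {T : Set (ℕ → Set (I ⊕ O))}
    {le : (ℕ → Set I) → (ℕ → Set I) → Prop} {E : Set (ℕ → Set (I ⊕ O))}
    {C : Set (ℕ → Set I)} (h : CF T le E C) : closeEffectSet T le E ⊆ C := by
  intro ρ hρ
  by_contra hC
  obtain ⟨_, -, hle, σ, hσ, rfl, hE⟩ := h ρ hC
  exact hE (hρ σ hσ hle)

theorem CF_closeEffectSet {I O : Type} {T : Set (ℕ → Set (I ⊕ O))}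
    {le : (ℕ → Set I) → (ℕ → Set I) → Prop} (hrefl : ∀ ρ, le ρ ρ)
    {E : Set (ℕ → Set (I ⊕ O))} : CF T le E (closeEffectSet T le E) := by
  intro ρ hρ
  simp only [closeEffectSet, Set.mem_ofPred_eq, not_forall] at hρ
  obtain ⟨σ, hσ, hle, hE⟩ := hρ
  exact ⟨inputProj σ, fun h => hE (h σ hσ (hrefl _)), hle, σ, hσ, rfl, hE⟩

theorem SAT_closeEffectSet {I O : Type} {T : Set (ℕ → Set (I ⊕ O))}
    {π : ℕ → Set (I ⊕ O)} {le : (ℕ → Set I) → (ℕ → Set I) → Prop}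
    (htrans : ∀ ρ0 ρ1 ρ2, le ρ0 ρ1 → le ρ1 ρ2 → le ρ0 ρ2)
    (hmin : ∀ ρ, le (inputProj π) ρ) {E : Set (ℕ → Set (I ⊕ O))}
    (h : (closeEffectSet T le E).Nonempty) : SAT T π E (closeEffectSet T le E) := by
  obtain ⟨ρ, hρ⟩ := h
  intro π0 hπ0 heq
  rw [heq]
  exact ⟨fun σ hσ hle => hρ σ hσ (htrans _ _ _ hle (hmin ρ)),
    hρ π0 hπ0 (heq ▸ hmin ρ)⟩

theorem SAT.closeEffectSet_nonempty {I O : Type} {T : Set (ℕ → Set (I ⊕ O))}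
    {π : ℕ → Set (I ⊕ O)} {le : (ℕ → Set I) → (ℕ → Set I) → Prop}
    (hantisymm : ∀ ρ0 ρ1, le ρ0 ρ1 → le ρ1 ρ0 → ρ0 = ρ1)
    (hmin : ∀ ρ, le (inputProj π) ρ) {E : Set (ℕ → Set (I ⊕ O))}
    {C : Set (ℕ → Set I)} (h : SAT T π E C) : (closeEffectSet T le E).Nonempty :=
  ⟨inputProj π, fun σ hσ hle => (h σ hσ (hantisymm _ _ hle (hmin _))).2⟩

/-- `C` is a cause of `E` on `π` in `T` iff `D` is nonempty and `C = D`;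
in particular, a cause exists iff `D` is nonempty. -/
theorem cause_iff_eq_D {I O : Type} (T : Set (ℕ → Set (I ⊕ O)))
    (π : ℕ → Set (I ⊕ O)) (hπ : π ∈ T)
    (le : (ℕ → Set I) → (ℕ → Set I) → Prop)
    (hrefl : ∀ ρ, le ρ ρ)
    (htrans : ∀ ρ0 ρ1 ρ2, le ρ0 ρ1 → le ρ1 ρ2 → le ρ0 ρ2)
    (hantisymm : ∀ ρ0 ρ1, le ρ0 ρ1 → le ρ1 ρ0 → ρ0 = ρ1)
    (hmin : ∀ ρ, le (inputProj π) ρ)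
    (E : Set (ℕ → Set (I ⊕ O)))
    (D : Set (ℕ → Set I))
    (hD : D = {ρ : ℕ → Set I | ∀ σ ∈ T, le (inputProj σ) ρ → σ ∈ E})
    (C : Set (ℕ → Set I)) :
    (IsCause T π le E C ↔ (D.Nonempty ∧ C = D)) ∧
    ((∃ C' : Set (ℕ → Set I), IsCause T π le E C') ↔ D ≠ ∅) := by
  change D = closeEffectSet T le E at hD
  subst hD
  have key (C : Set (ℕ → Set I)) : IsCause T π le E C ↔
      (closeEffectSet T le E).Nonempty ∧ C = closeEffectSet T le E := by
    constructor
    · rintro ⟨hS, hC, hM⟩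
      have hne := hS.closeEffectSet_nonempty hantisymm hmin
      refine ⟨hne, by_contra fun hCD => hM ⟨_, ?_, SAT_closeEffectSet htrans hmin hne,
        CF_closeEffectSet hrefl⟩⟩
      exact hC.closeEffectSet_subset.ssubset_of_ne (Ne.symm hCD)
    · rintro ⟨hne, rfl⟩
      refine ⟨SAT_closeEffectSet htrans hmin hne, CF_closeEffectSet hrefl, ?_⟩
      rintro ⟨C', hss, -, hC'⟩
      exact hss.not_subset hC'.closeEffectSet_subset
  refine ⟨key C, ?_⟩
  rw [← Set.nonempty_iff_ne_empty]
  exact ⟨fun ⟨C', h⟩ => ((key C').1 h).1, fun h => ⟨_, (key _).2 ⟨h, rfl⟩⟩⟩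
end

section
/- Let T be a set of traces, π ∈ T, ≤_π a comparative similarity relation, and E a set of traces. If the set D = {ρ an input sequence | ∀ σ ∈ T, σ|_I ≤_π ρ → σ ∈ E} is nonempty, then D satisfies SAT: every trace π0 ∈ T with π0 =_I π satisfies π0|_I ∈ D and π0 ∈ E. -/
/-- If the set `D` is nonempty, then it satisfies SAT. -/
theorem D_satisfies_SAT {I O : Type} (T : Set (ℕ → Set (I ⊕ O)))
    (π : ℕ → Set (I ⊕ O)) (hπ : π ∈ T)
    (le : (ℕ → Set I) → (ℕ → Set I) → Prop)
    (hrefl : ∀ ρ, le ρ ρ)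
    (htrans : ∀ ρ0 ρ1 ρ2, le ρ0 ρ1 → le ρ1 ρ2 → le ρ0 ρ2)
    (hantisymm : ∀ ρ0 ρ1, le ρ0 ρ1 → le ρ1 ρ0 → ρ0 = ρ1)
    (hmin : ∀ ρ, le (inputProj π) ρ)
    (E : Set (ℕ → Set (I ⊕ O)))
    (D : Set (ℕ → Set I))
    (hD : D = {ρ : ℕ → Set I | ∀ σ ∈ T, le (inputProj σ) ρ → σ ∈ E})
    (hne : D.Nonempty) :
    SAT T π E D := by
  subst hD
  obtain ⟨ρ, hρ⟩ := hne
  intro π0 h0 heq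
  rw [heq]
  exact ⟨fun σ hσ hle => hρ σ hσ (htrans _ _ _ hle (hmin ρ)),
    hρ π0 h0 (heq ▸ hmin ρ)⟩
end

section
/- Let T be a set of traces, π ∈ T, ≤_π a comparative similarity relation, and E a set of traces. If C and C' are sets of input sequences that each satisfy both SAT and CF, then the intersection C ∩ C' also satisfies both SAT and CF. -/
/-- The intersection of two sets each satisfying SAT and CF again satisfies SAT and CF. -/
theorem inter_satisfies_SAT_CF {I O : Type} (T : Set (ℕ → Set (I ⊕ O)))
    (π : ℕ → Set (I ⊕ O)) (hπ : π ∈ T)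
    (le : (ℕ → Set I) → (ℕ → Set I) → Prop)
    (hrefl : ∀ ρ, le ρ ρ)
    (htrans : ∀ ρ0 ρ1 ρ2, le ρ0 ρ1 → le ρ1 ρ2 → le ρ0 ρ2)
    (hantisymm : ∀ ρ0 ρ1, le ρ0 ρ1 → le ρ1 ρ0 → ρ0 = ρ1)
    (hmin : ∀ ρ, le (inputProj π) ρ)
    (E : Set (ℕ → Set (I ⊕ O)))
    (C C' : Set (ℕ → Set I))
    (hC : SAT T π E C ∧ CF T le E C)
    (hC' : SAT T π E C' ∧ CF T le E C') :
    SAT T π E (C ∩ C') ∧ CF T le E (C ∩ C') := by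
  obtain ⟨hS, hF⟩ := hC
  obtain ⟨hS', hF'⟩ := hC'
  refine ⟨fun π0 h0 heq => ⟨⟨(hS π0 h0 heq).1, (hS' π0 h0 heq).1⟩, (hS π0 h0 heq).2⟩, ?_⟩
  intro π0 h0
  by_cases h : π0 ∈ C
  · obtain ⟨π1, h1, hle, hex⟩ := hF' π0 fun h' => h0 ⟨h, h'⟩
    exact ⟨π1, fun hm => h1 hm.2, hle, hex⟩
  · obtain ⟨π1, h1, hle, hex⟩ := hF π0 h
    exact ⟨π1, fun hm => h1 hm.1, hle, hex⟩
end

section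
/- Let T be a set of traces, π ∈ T, ≤_π a comparative similarity relation, and E a set of traces, and let D = {ρ an input sequence | ∀ σ ∈ T, σ|_I ≤_π ρ → σ ∈ E}. Then D is the largest downward-closed set of input sequences all of whose system realizations satisfy the effect, i.e.: (i) every trace σ ∈ T with σ|_I ∈ D satisfies σ ∈ E; (ii) D is downward closed with respect to ≤_π; and (iii) every set D' of input sequences that is downward closed with respect to ≤_π and such that every trace σ ∈ T with σ|_I ∈ D' satisfies σ ∈ E is contained in D. -/
/-- `D` is the largest downward-closed set of input sequences all of whose system
realizations satisfy the effect. -/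
theorem D_largest_downward_closed {I O : Type} (T : Set (ℕ → Set (I ⊕ O)))
    (π : ℕ → Set (I ⊕ O)) (hπ : π ∈ T)
    (le : (ℕ → Set I) → (ℕ → Set I) → Prop)
    (hrefl : ∀ ρ, le ρ ρ)
    (htrans : ∀ ρ0 ρ1 ρ2, le ρ0 ρ1 → le ρ1 ρ2 → le ρ0 ρ2)
    (hantisymm : ∀ ρ0 ρ1, le ρ0 ρ1 → le ρ1 ρ0 → ρ0 = ρ1)
    (hmin : ∀ ρ, le (inputProj π) ρ)
    (E : Set (ℕ → Set (I ⊕ O)))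
    (D : Set (ℕ → Set I))
    (hD : D = {ρ : ℕ → Set I | ∀ σ ∈ T, le (inputProj σ) ρ → σ ∈ E}) :
    (∀ σ ∈ T, inputProj σ ∈ D → σ ∈ E) ∧
    (∀ ρ ∈ D, ∀ ρ' : ℕ → Set I, le ρ' ρ → ρ' ∈ D) ∧
    (∀ D' : Set (ℕ → Set I),
      (∀ ρ ∈ D', ∀ ρ' : ℕ → Set I, le ρ' ρ → ρ' ∈ D') →
      (∀ σ ∈ T, inputProj σ ∈ D' → σ ∈ E) →
      D' ⊆ D) := by
  subst hD
  refine ⟨fun σ hσ h => h σ hσ (hrefl _), fun ρ hρ ρ' hle σ hσ h => ?_,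
    fun D' hdown hE ρ hρ σ hσ h => ?_⟩
  · exact hρ σ hσ (htrans _ _ _ h hle)
  · exact hE σ hσ (hdown ρ hρ _ h)
end
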